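/- arXiv:2501.19294 — 8 statements merged into one kernel-verified Lean document; each statement's English description precedes it below -/
import Mathlib

section
/- For every real number β > 0, it holds that β · (β^(−β/(β+1)) + β^(1/(β+1)))^((β+1)/β) > 1. -/
/-- Fact A.4: for every real `β > 0`,
`β · (β^(−β/(β+1)) + β^(1/(β+1)))^((β+1)/β) > 1`. -/
theorem beta_expression_gt_one (β : ℝ) (hβ : 0 < β) :
    1 < β * (β ^ (-(β / (β + 1))) + β ^ (1 / (β + 1))) ^ ((β + 1) / β) := by
  have hpow : (β ^ (-(β / (β + 1)))) ^ ((β + 1) / β) = β⁻¹ := by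
    rw [← Real.rpow_mul hβ.le, ← Real.rpow_neg_one]
    congr 1
    field_simp
  have hlt : β⁻¹ < (β ^ (-(β / (β + 1))) + β ^ (1 / (β + 1))) ^ ((β + 1) / β) := by
    rw [← hpow]
    exact Real.rpow_lt_rpow (by positivity)
      (lt_add_of_pos_right _ (by positivity)) (by positivity)
  calc
    1 = β * β⁻¹ := (mul_inv_cancel₀ hβ.ne').symm
    _ < _ := mul_lt_mul_of_pos_left hlt hβ
end

section
/- Let Z, α, β, ρ, κ be positive reals, let 𝒢(n) := max(Z − α·n^(−β), 0) for n > 0, and set n* := (ρ·α·β/κ)^(1/(β+1)). Then ρ·𝒢(n*) − κ·n* ≥ 0 if and only if κ ≤ ρ·c_𝒢. -/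
/-- Claim 4.2 (sellers' baseline participation threshold): with
`n* = (ρ·α·β/κ)^(1/(β+1))`, the sellers' utility `ρ·𝒢(n*) − κ·n*` is
nonnegative iff `κ ≤ ρ·c_𝒢`. -/
theorem baseline_participation_threshold
    (Z α β ρ κ : ℝ) (hZ : 0 < Z) (hα : 0 < α) (hβ : 0 < β)
    (hρ : 0 < ρ) (hκ : 0 < κ)
    (cG : ℝ)
    (hcG : cG = Z ^ ((β + 1) / β) /
      (α ^ (1 / β) * (β ^ (-(β / (β + 1))) + β ^ (1 / (β + 1))) ^ ((β + 1) / β)))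
    (G : ℝ → ℝ) (hG : ∀ n : ℝ, G n = max (Z - α * n ^ (-β)) 0)
    (nstar : ℝ) (hn : nstar = (ρ * α * β / κ) ^ (1 / (β + 1))) :
    0 ≤ ρ * G nstar - κ * nstar ↔ κ ≤ ρ * cG := by
  set p := (β + 1) / β with hp
  have hb1 : 0 < β + 1 := by linarith
  have hp0 : 0 < p := by positivity
  set S := β ^ (-(β / (β + 1))) + β ^ (1 / (β + 1)) with hS
  have hS0 : 0 < S := by positivity
  have hn0 : 0 < nstar := by rw [hn]; positivity
  have hS_eq : S = β ^ (-(β / (β + 1))) * (β + 1) := by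
    have h : (1 : ℝ) / (β + 1) = -(β / (β + 1)) + 1 := by field_simp; ring
    rw [hS, h, Real.rpow_add hβ, Real.rpow_one]; ring
  have hpow : nstar ^ (-β) = β ^ (-(β / (β + 1))) * (κ / (ρ * α)) ^ (β / (β + 1)) := by
    have h : ρ * α * β / κ = β * (κ / (ρ * α))⁻¹ := by field_simp
    have e : 1 / (β + 1) * -β = -(β / (β + 1)) := by ring
    rw [hn, ← Real.rpow_mul (by positivity), e, h, Real.mul_rpow hβ.le (by positivity),
      Real.inv_rpow (by positivity), Real.rpow_neg (x := κ / (ρ * α)) (by positivity), inv_inv]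
  have hfoc : κ * nstar = ρ * α * β * nstar ^ (-β) := by
    have h : nstar ^ (β + 1) = ρ * α * β / κ := by
      rw [hn, ← Real.rpow_mul (by positivity), one_div_mul_cancel hb1.ne', Real.rpow_one]
    have h' : nstar = nstar ^ (β + 1) * nstar ^ (-β) := by
      rw [← Real.rpow_add hn0]; simp
    calc κ * nstar = κ * (nstar ^ (β + 1) * nstar ^ (-β)) := by rw [← h']
      _ = _ := by rw [h]; field_simp
  have hT : (α * S * (κ / (ρ * α)) ^ (β / (β + 1))) ^ p = α ^ (1 / β) * S ^ p * (κ / ρ) := by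
    have e : β / (β + 1) * p = 1 := by rw [hp]; field_simp
    have e' : p = 1 / β + 1 := by rw [hp]; field_simp; ring
    have hαp : α ^ p = α ^ (1 / β) * α := by rw [e', Real.rpow_add hα, Real.rpow_one]
    rw [Real.mul_rpow (by positivity) (by positivity), Real.mul_rpow hα.le hS0.le,
      ← Real.rpow_mul (by positivity), e, Real.rpow_one, hαp]
    field_simp
  have hmain : 0 ≤ ρ * G nstar - κ * nstar ↔ α * S * (κ / (ρ * α)) ^ (β / (β + 1)) ≤ Z := by
    have hTeq : α * S * (κ / (ρ * α)) ^ (β / (β + 1)) = α * (β + 1) * nstar ^ (-β) := by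
      rw [hpow, hS_eq]; ring
    have hκn : 0 < κ * nstar := by positivity
    have hdiff : ρ * (Z - α * nstar ^ (-β)) - κ * nstar
        = ρ * (Z - α * (β + 1) * nstar ^ (-β)) := by rw [hfoc]; ring
    rw [hTeq, hG, ← sub_nonneg (a := Z), 
      ← mul_nonneg_iff_of_pos_left (b := Z - α * (β + 1) * nstar ^ (-β)) hρ, ← hdiff]
    constructor
    · intro h
      rcases max_cases (Z - α * nstar ^ (-β)) 0 with ⟨h1, -⟩ | ⟨h1, -⟩ <;> rw [h1] at h
      · exact h
      · linarith
    · intro h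
      linarith [mul_le_mul_of_nonneg_left (le_max_left (Z - α * nstar ^ (-β)) 0) hρ.le]
  rw [hmain, ← Real.rpow_le_rpow_iff (by positivity) hZ.le hp0, hT, hcG, ← div_le_iff₀' hρ,
    le_div_iff₀' (by positivity)]
end

section
/- Let Z, α, β be positive reals and let a, b be positive reals with b ≤ a·c_𝒢. Then (a·α·β/b)^(1/(β+1)) > (α/Z)^(1/β). -/
theorem rpow_add_rpow_rpow_eq {β : ℝ} (hβ : 0 < β) :
    (β ^ (-(β / (β + 1))) + β ^ (1 / (β + 1))) ^ ((β + 1) / β) =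
      β⁻¹ * (1 + β) ^ ((β + 1) / β) := by
  have hsum : β ^ (-(β / (β + 1))) + β ^ (1 / (β + 1)) = β ^ (-(β / (β + 1))) * (1 + β) := by
    have hexp : 1 / (β + 1) = -(β / (β + 1)) + 1 := by field_simp; ring
    rw [hexp, Real.rpow_add hβ, Real.rpow_one]
    ring
  have hexp : -(β / (β + 1)) * ((β + 1) / β) = -1 := by field_simp
  rw [hsum, Real.mul_rpow (by positivity) (by positivity), ← Real.rpow_mul hβ.le, hexp,
    Real.rpow_neg_one]

/-- If the production cost `b` is at most the participation threshold `a·c_𝒢`,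
then the optimal number of samples exceeds the learning ante. -/
theorem optimal_samples_exceed_learning_ante
    (Z α β a b : ℝ) (hZ : 0 < Z) (hα : 0 < α) (hβ : 0 < β)
    (ha : 0 < a) (hb : 0 < b)
    (cG : ℝ)
    (hcG : cG = Z ^ ((β + 1) / β) /
      (α ^ (1 / β) * (β ^ (-(β / (β + 1))) + β ^ (1 / (β + 1))) ^ ((β + 1) / β)))
    (hthresh : b ≤ a * cG) :
    (α / Z) ^ (1 / β) < (a * α * β / b) ^ (1 / (β + 1)) := by
  rw [rpow_add_rpow_rpow_eq hβ] at hcG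
  have hexp : 1 / β = (β + 1) / β * (1 / (β + 1)) := by field_simp
  have hαp : α ^ ((β + 1) / β) = α * α ^ (1 / β) := by
    have h : (β + 1) / β = 1 + 1 / β := by field_simp
    rw [h, Real.rpow_add hα, Real.rpow_one]
  have hpow : 1 < (1 + β) ^ ((β + 1) / β) :=
    Real.one_lt_rpow (by linarith) (by positivity)
  rw [hexp, Real.rpow_mul (by positivity)]
  refine Real.rpow_lt_rpow (by positivity) ?_ (by positivity)
  rw [lt_div_iff₀ hb]
  calc (α / Z) ^ ((β + 1) / β) * b ≤ (α / Z) ^ ((β + 1) / β) * (a * cG) := by gcongr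
    _ = a * α * β / (1 + β) ^ ((β + 1) / β) := by
      rw [hcG, Real.div_rpow hα.le hZ.le, hαp]
      have hZp : 0 < Z ^ ((β + 1) / β) := by positivity
      have hαq : 0 < α ^ (1 / β) := by positivity
      generalize Z ^ ((β + 1) / β) = x at *
      generalize α ^ (1 / β) = y at *
      generalize (1 + β) ^ ((β + 1) / β) = z at *
      field_simp
    _ < a * α * β := div_lt_self (by positivity) hpow
end

section
/- Let H be a nonempty finite index set, let Z, α, β, c be positive reals, and for each g ∈ H let ρ_g > 0 and γ_g > 0 be reals. Set n* := ((α·β/c)·Σ_{g∈H} ρ_g·γ_g^(−β))^(1/(β+1)), and assume γ_g·n* > (α/Z)^(1/β) for every g ∈ H. Then Σ_{g∈H} ρ_g·(Z − α·(γ_g·n*)^(−β)) − c·n* ≥ 0 if and only if c ≤ ((Σ_{g∈H} ρ_g)^((β+1)/β) / (Σ_{g∈H} ρ_g·γ_g^(−β))^(1/β)) · c_𝒢. -/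
theorem rpow_neg_add_rpow_rpow {β : ℝ} (hβ : 0 < β) :
    (β ^ (-(β / (β + 1))) + β ^ (1 / (β + 1))) ^ ((β + 1) / β) =
      (β + 1) ^ ((β + 1) / β) / β := by
  have h : β ^ (1 / (β + 1)) = β ^ (-(β / (β + 1))) * β := by
    rw [← Real.rpow_add_one hβ.ne']
    congr 1
    field_simp
    ring
  rw [h, show β ^ (-(β / (β + 1))) + β ^ (-(β / (β + 1))) * β =
      β ^ (-(β / (β + 1))) * (β + 1) by ring, Real.mul_rpow (by positivity) (by positivity),
    ← Real.rpow_mul hβ.le, show -(β / (β + 1)) * ((β + 1) / β) = -1 by field_simp,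
    Real.rpow_neg_one]
  ring


open Finset in
/-- Claim 4.4 (sellers' intervention participation threshold). -/
theorem intervention_participation_threshold
    {ι : Type*} (H : Finset ι) (hH : H.Nonempty)
    (Z α β c : ℝ) (hZ : 0 < Z) (hα : 0 < α) (hβ : 0 < β) (hc : 0 < c)
    (ρ γ : ι → ℝ) (hρ : ∀ g ∈ H, 0 < ρ g) (hγ : ∀ g ∈ H, 0 < γ g)
    (cG : ℝ)
    (hcG : cG = Z ^ ((β + 1) / β) /
      (α ^ (1 / β) * (β ^ (-(β / (β + 1))) + β ^ (1 / (β + 1))) ^ ((β + 1) / β)))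
    (nstar : ℝ)
    (hn : nstar = ((α * β / c) * ∑ g ∈ H, ρ g * (γ g) ^ (-β)) ^ (1 / (β + 1)))
    (hante : ∀ g ∈ H, γ g * nstar > (α / Z) ^ (1 / β)) :
    0 ≤ (∑ g ∈ H, ρ g * (Z - α * (γ g * nstar) ^ (-β))) - c * nstar ↔
      c ≤ ((∑ g ∈ H, ρ g) ^ ((β + 1) / β) /
        (∑ g ∈ H, ρ g * (γ g) ^ (-β)) ^ (1 / β)) * cG := by
  have hR : 0 < ∑ g ∈ H, ρ g := sum_pos hρ hH
  have hS : 0 < ∑ g ∈ H, ρ g * (γ g) ^ (-β) :=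
    sum_pos (fun g hg => mul_pos (hρ g hg) (Real.rpow_pos_of_pos (hγ g hg) _)) hH
  have hn0 : 0 < nstar := by rw [hn]; positivity
  have hsum : ∑ g ∈ H, ρ g * (Z - α * (γ g * nstar) ^ (-β)) =
      Z * (∑ g ∈ H, ρ g) - α * (∑ g ∈ H, ρ g * (γ g) ^ (-β)) * nstar ^ (-β) := by
    rw [mul_sum, mul_sum, sum_mul, ← sum_sub_distrib]
    refine sum_congr rfl fun g hg => ?_
    rw [Real.mul_rpow (hγ g hg).le hn0.le]
    ring
  rw [hsum, hcG]
  generalize (∑ g ∈ H, ρ g * (γ g) ^ (-β)) = S at *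
  generalize (∑ g ∈ H, ρ g) = R at *
  have hpow : nstar ^ (β + 1) = α * β / c * S := by
    rw [hn, ← Real.rpow_mul (by positivity), one_div_mul_cancel (by positivity), Real.rpow_one]
  have hcost : c * nstar = α * β * S * nstar ^ (-β) := by
    have h : nstar = nstar ^ (β + 1) * nstar ^ (-β) := by
      rw [← Real.rpow_add hn0]
      simp
    calc c * nstar = c * (nstar ^ (β + 1) * nstar ^ (-β)) := by rw [← h]
      _ = α * β * S * nstar ^ (-β) := by
        rw [hpow]
        field_simp
  have hq : (nstar ^ (-β)) ^ ((β + 1) / β) = c / (α * β * S) := by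
    rw [← Real.rpow_mul hn0.le, show -β * ((β + 1) / β) = -(β + 1) by field_simp,
      Real.rpow_neg hn0.le, hpow]
    field_simp
  have hK := rpow_neg_add_rpow_rpow hβ
  have hp : ∀ x : ℝ, 0 < x → x ^ ((β + 1) / β) = x * x ^ (1 / β) := fun x hx => by
    rw [add_div, div_self hβ.ne', Real.rpow_add hx, Real.rpow_one]
  have hb : 0 < β + 1 := by positivity
  calc 0 ≤ Z * R - α * S * nstar ^ (-β) - c * nstar
      ↔ α * S * (β + 1) * nstar ^ (-β) ≤ R * Z := by
        rw [hcost]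
        constructor <;> intro h <;> linarith
    _ ↔ (α * S * (β + 1) * nstar ^ (-β)) ^ ((β + 1) / β) ≤ (R * Z) ^ ((β + 1) / β) :=
        (Real.rpow_le_rpow_iff (by positivity) (by positivity) (by positivity)).symm
    _ ↔ c * (α ^ (1 / β) * S ^ (1 / β) * ((β + 1) ^ ((β + 1) / β) / β)) ≤
          R ^ ((β + 1) / β) * Z ^ ((β + 1) / β) := by
        rw [Real.mul_rpow (by positivity) (by positivity), hq,
          Real.mul_rpow (by positivity) hb.le, Real.mul_rpow hα.le hS.le,
          Real.mul_rpow hR.le hZ.le, hp α hα, hp S hS]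
        refine iff_of_eq (congrArg (· ≤ _) ?_)
        field_simp
    _ ↔ _ := by
        rw [hK, div_mul_div_comm, le_div_iff₀ (by positivity)]
        refine iff_of_eq (congrArg (· ≤ _) ?_)
        ring
end

section
/- Let Z, α, β > 0 be reals, let H be a nonempty finite index set, and for each g ∈ H let ρ_g > 0 be a real. Consider the function γ ↦ ((Σ_{g∈H} ρ_g)^((β+1)/β) / (Σ_{g∈H} ρ_g·γ_g^(−β))^(1/β)) · c_𝒢 on the set of families γ with γ_g > 0 for all g and Σ_{g∈H} γ_g = 1. Its maximum value over this set equals ((Σ_{g∈H} ρ_g) / (Σ_{g∈H} ρ_g^(1/(β+1))))^((β+1)/β) · c_𝒢, and the maximum is attained exactly at γ_g = ρ_g^(1/(β+1)) / (Σ_{h∈H} ρ_h^(1/(β+1))). -/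
open Finset in
/-- Jensen's inequality for `x ↦ x ^ p` with weights `w` at the points `a g / w g`, together with
its equality case. -/
theorem rpow_sum_le_sum_weight_mul_div_rpow {ι : Type*} (s : Finset ι) {p : ℝ} (hp : 1 < p)
    {a w : ι → ℝ} (ha : ∀ g ∈ s, 0 < a g) (hw : ∀ g ∈ s, 0 < w g) (hw1 : ∑ g ∈ s, w g = 1) :
    (∑ g ∈ s, a g) ^ p ≤ ∑ g ∈ s, w g * (a g / w g) ^ p ∧
      ((∑ g ∈ s, a g) ^ p = ∑ g ∈ s, w g * (a g / w g) ^ p ↔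
        ∀ g ∈ s, a g / w g = ∑ h ∈ s, a h) := by
  have hmem : ∀ g ∈ s, a g / w g ∈ Set.Ici (0 : ℝ) :=
    fun g hg => (div_pos (ha g hg) (hw g hg)).le
  have hsum : ∑ g ∈ s, w g • (a g / w g) = ∑ g ∈ s, a g :=
    sum_congr rfl fun g hg => by
      rw [smul_eq_mul, mul_div_cancel₀ _ (hw g hg).ne']
  have hconv := strictConvexOn_rpow hp
  have hle := hconv.convexOn.map_sum_le (fun g hg => (hw g hg).le) hw1 hmem
  have heq := hconv.map_sum_eq_iff hw hw1 hmem
  rw [hsum] at hle heq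
  exact ⟨hle, heq⟩

/-- The perspective of `y ↦ y ^ (β + 1)` at `ρ ^ (1 / (β + 1))`. -/
theorem mul_div_rpow_add_one {β ρ x : ℝ} (hβ : 0 < β) (hρ : 0 < ρ) (hx : 0 < x) :
    x * (ρ ^ (1 / (β + 1)) / x) ^ (β + 1) = ρ * x ^ (-β) := by
  have h : (β + 1) ≠ 0 := by positivity
  rw [Real.div_rpow (by positivity) hx.le, ← Real.rpow_mul hρ.le, one_div_mul_cancel h,
    Real.rpow_one, Real.rpow_add_one hx.ne', Real.rpow_neg hx.le]
  have := Real.rpow_pos_of_pos hx β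
  field_simp

open Finset in
/-- The first major step in the proof of Theorem 5.3: the intervention
participation threshold `τ_H(ρ, γ)`, as a function of the target vector `γ` on
the open probability simplex, attains its maximum value
`((Σ ρ_g)/(Σ ρ_g^(1/(β+1))))^((β+1)/β)·c_𝒢` exactly at
`γ_g = ρ_g^(1/(β+1)) / Σ_h ρ_h^(1/(β+1))`. -/
theorem threshold_maximization
    (Z α β : ℝ) (hZ : 0 < Z) (hα : 0 < α) (hβ : 0 < β)
    {ι : Type*} (H : Finset ι) (hH : H.Nonempty)
    (ρ : ι → ℝ) (hρ : ∀ g ∈ H, 0 < ρ g)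
    (cG : ℝ)
    (hcG : cG = Z ^ ((β + 1) / β) /
      (α ^ (1 / β) * (β ^ (-(β / (β + 1))) + β ^ (1 / (β + 1))) ^ ((β + 1) / β))) :
    ∀ γ : ι → ℝ, (∀ g ∈ H, 0 < γ g) → (∑ g ∈ H, γ g) = 1 →
      (((∑ g ∈ H, ρ g) ^ ((β + 1) / β) /
          (∑ g ∈ H, ρ g * (γ g) ^ (-β)) ^ (1 / β)) * cG ≤
        ((∑ g ∈ H, ρ g) / (∑ g ∈ H, (ρ g) ^ (1 / (β + 1)))) ^ ((β + 1) / β) * cG ∧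
      (((∑ g ∈ H, ρ g) ^ ((β + 1) / β) /
          (∑ g ∈ H, ρ g * (γ g) ^ (-β)) ^ (1 / β)) * cG =
        ((∑ g ∈ H, ρ g) / (∑ g ∈ H, (ρ g) ^ (1 / (β + 1)))) ^ ((β + 1) / β) * cG ↔
        ∀ g ∈ H, γ g = (ρ g) ^ (1 / (β + 1)) / ∑ h ∈ H, (ρ h) ^ (1 / (β + 1)))) := by
  intro γ hγ hγ1
  have hcG_pos : 0 < cG := by rw [hcG]; positivity
  have ha : ∀ g ∈ H, 0 < ρ g ^ (1 / (β + 1)) := fun g hg => Real.rpow_pos_of_pos (hρ g hg) _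
  obtain ⟨hle, heq⟩ := rpow_sum_le_sum_weight_mul_div_rpow H (p := β + 1) (by linarith) ha hγ hγ1
  rw [sum_congr rfl fun g hg => mul_div_rpow_add_one hβ (hρ g hg) (hγ g hg)] at hle heq
  have hR : 0 < ∑ g ∈ H, ρ g := sum_pos hρ hH
  have hA : 0 < ∑ g ∈ H, ρ g ^ (1 / (β + 1)) := sum_pos ha hH
  have hγ_iff : (∀ g ∈ H, ρ g ^ (1 / (β + 1)) / γ g = ∑ h ∈ H, ρ h ^ (1 / (β + 1))) ↔
      ∀ g ∈ H, γ g = ρ g ^ (1 / (β + 1)) / ∑ h ∈ H, ρ h ^ (1 / (β + 1)) :=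
    forall₂_congr fun g hg => by
      rw [div_eq_iff (hγ g hg).ne', eq_div_iff hA.ne', mul_comm (γ g), eq_comm]
  rw [hγ_iff] at heq
  set A := ∑ g ∈ H, ρ g ^ (1 / (β + 1))
  set S := ∑ g ∈ H, ρ g * γ g ^ (-β)
  have hAp : 0 < A ^ (β + 1) := Real.rpow_pos_of_pos hA _
  have hS : 0 < S := hAp.trans_le hle
  have hβ' : 0 < 1 / β := by positivity
  have hRq : 0 < (∑ g ∈ H, ρ g) ^ ((β + 1) / β) := Real.rpow_pos_of_pos hR _
  have hAq : A ^ ((β + 1) / β) = (A ^ (β + 1)) ^ (1 / β) := by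
    rw [← Real.rpow_mul hA.le, mul_one_div]
  rw [Real.div_rpow hR.le hA.le, hAq]
  refine ⟨by gcongr, ?_⟩
  rw [mul_left_inj' hcG_pos.ne', div_eq_mul_inv _ (S ^ (1 / β)),
    div_eq_mul_inv _ ((A ^ (β + 1)) ^ (1 / β)), mul_right_inj' hRq.ne', inv_inj,
    Real.rpow_left_inj hS.le hAp.le hβ'.ne', eq_comm, heq]
end

section
/- Let Z, α, β > 0 be reals and let G be a nonempty finite index set. For each g ∈ G let ρ_g > 0, κ_g > 0, and γ_g > 0 be reals with Σ_{g∈G} γ_g = 1. Let a, b > 0 satisfy 1/a = min_{g∈G} γ_g and 1/b = max_{g∈G} γ_g, let r be a real with ρ_f ≤ r·ρ_g for all f, g ∈ G, and let η ≥ 0 be a real with κ_g ≤ η·ρ_g·c_𝒢 for all g ∈ G and η < (b/a)^(β+1)/(r·|G|). Then for every nonempty subset H ⊆ G, Σ_{g∈G} κ_g·γ_g ≤ ((Σ_{h∈H} ρ_h)^((β+1)/β) / (Σ_{h∈H} ρ_h·γ_h^(−β))^(1/β)) · c_𝒢. -/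
open Finset in
/-- If `c ≤ w h` on `H`, the quotient of the power of the total mass by the weighted
negative-power sum is at least `c` times the total mass. -/
theorem mul_sum_le_rpow_sum_div {ι : Type*} {H : Finset ι} (hH : H.Nonempty)
    {ρ w : ι → ℝ} {β c : ℝ} (hβ : 0 < β) (hc : 0 < c)
    (hρ : ∀ h ∈ H, 0 < ρ h) (hw : ∀ h ∈ H, c ≤ w h) :
    c * ∑ h ∈ H, ρ h ≤
      (∑ h ∈ H, ρ h) ^ ((β + 1) / β) / (∑ h ∈ H, ρ h * (w h) ^ (-β)) ^ (1 / β) := by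
  have hS : 0 < ∑ h ∈ H, ρ h := sum_pos hρ hH
  have hT : 0 < ∑ h ∈ H, ρ h * (w h) ^ (-β) :=
    sum_pos (fun h hh => mul_pos (hρ h hh)
      (Real.rpow_pos_of_pos (hc.trans_le (hw h hh)) _)) hH
  have hTle : ∑ h ∈ H, ρ h * (w h) ^ (-β) ≤ (∑ h ∈ H, ρ h) * c ^ (-β) := by
    rw [sum_mul]
    exact sum_le_sum fun h hh => mul_le_mul_of_nonneg_left
      (Real.rpow_le_rpow_of_nonpos hc (hw h hh) (by linarith)) (hρ h hh).le
  have hroot : (∑ h ∈ H, ρ h * (w h) ^ (-β)) ^ (1 / β) ≤ (∑ h ∈ H, ρ h) ^ (1 / β) * c⁻¹ := by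
    refine (Real.rpow_le_rpow hT.le hTle (by positivity)).trans_eq ?_
    rw [Real.mul_rpow hS.le (by positivity), ← Real.rpow_mul hc.le,
      show -β * (1 / β) = -1 by field_simp, Real.rpow_neg_one]
  rw [le_div_iff₀ (Real.rpow_pos_of_pos hT _)]
  refine (mul_le_mul_of_nonneg_left hroot (by positivity)).trans_eq ?_
  rw [show (β + 1) / β = 1 + 1 / β by field_simp, Real.rpow_add hS, Real.rpow_one]
  field_simp

open Finset in
/-- Theorem 5.4, first half: if the slack `η` is small enough relative to the
skew of the intervention and of the potential economic values, then the
marginal cost of a balanced sample is at most the intervention participation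
threshold for every nonempty subset of groups. -/
theorem sufficient_conditions_cost_below_threshold
    (Z α β : ℝ) (hZ : 0 < Z) (hα : 0 < α) (hβ : 0 < β)
    {ι : Type*} (G : Finset ι) (hG : G.Nonempty)
    (ρ κ γ : ι → ℝ) (hρ : ∀ g ∈ G, 0 < ρ g) (hκ : ∀ g ∈ G, 0 < κ g)
    (hγ : ∀ g ∈ G, 0 < γ g) (hγsum : (∑ g ∈ G, γ g) = 1)
    (cG : ℝ)
    (hcG : cG = Z ^ ((β + 1) / β) /
      (α ^ (1 / β) * (β ^ (-(β / (β + 1))) + β ^ (1 / (β + 1))) ^ ((β + 1) / β)))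
    (a b : ℝ) (ha : 0 < a) (hb : 0 < b)
    (hamin : IsLeast ((G : Set ι).image γ) (1 / a))
    (hbmax : IsGreatest ((G : Set ι).image γ) (1 / b))
    (r : ℝ) (hr : ∀ f ∈ G, ∀ g ∈ G, ρ f ≤ r * ρ g)
    (η : ℝ) (hη0 : 0 ≤ η) (hηκ : ∀ g ∈ G, κ g ≤ η * (ρ g * cG))
    (hη : η < (b / a) ^ (β + 1) / (r * G.card)) :
    ∀ H ⊆ G, H.Nonempty →
      (∑ g ∈ G, κ g * γ g) ≤
        ((∑ h ∈ H, ρ h) ^ ((β + 1) / β) /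
          (∑ h ∈ H, ρ h * (γ h) ^ (-β)) ^ (1 / β)) * cG := by
  intro H hHG hH
  obtain ⟨h₀, hh₀⟩ := hH
  have hmin : ∀ g ∈ G, 1 / a ≤ γ g := fun g hg => hamin.2 ⟨g, hg, rfl⟩
  have hmax : ∀ g ∈ G, γ g ≤ 1 / b := fun g hg => hbmax.2 ⟨g, hg, rfl⟩
  have hc : 0 < cG := by rw [hcG]; positivity
  have hn : (0 : ℝ) < G.card := by exact_mod_cast hG.card_pos
  have hρ₀ : 0 < ρ h₀ := hρ h₀ (hHG hh₀)
  have hr0 : 0 < r :=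
    pos_of_mul_pos_left (hρ₀.trans_le (hr h₀ (hHG hh₀) h₀ (hHG hh₀))) hρ₀.le
  have hba : b / a ≤ 1 := by
    have h := (hmin h₀ (hHG hh₀)).trans (hmax h₀ (hHG hh₀))
    rw [div_le_one ha]
    exact (one_div_le_one_div ha hb).1 h
  have hbn : b ≤ G.card := by
    have h : (1 : ℝ) ≤ G.card * (1 / b) := by
      simpa only [hγsum, nsmul_eq_mul] using sum_le_card_nsmul G γ (1 / b) hmax
    rwa [mul_one_div, le_div_iff₀ hb, one_mul] at h
  have hηr : η * r ≤ 1 / a := by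
    have hpow : (b / a) ^ (β + 1) ≤ b / a := by
      simpa using Real.rpow_le_rpow_of_exponent_ge (div_pos hb ha) hba
        (show (1 : ℝ) ≤ β + 1 by linarith)
    rw [lt_div_iff₀ (by positivity)] at hη
    refine le_of_mul_le_mul_right ?_ hn
    calc η * r * G.card ≤ b / a := by linarith
      _ ≤ G.card / a := by gcongr
      _ = 1 / a * G.card := by ring
  have hρS : ρ h₀ ≤ ∑ h ∈ H, ρ h :=
    single_le_sum (fun h hh => (hρ h (hHG hh)).le) hh₀
  calc ∑ g ∈ G, κ g * γ g ≤ ∑ g ∈ G, η * (r * ρ h₀ * cG) * γ g :=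
        sum_le_sum fun g hg => mul_le_mul_of_nonneg_right
          ((hηκ g hg).trans (by gcongr; exact hr g hg h₀ (hHG hh₀))) (hγ g hg).le
    _ = η * r * ρ h₀ * cG := by rw [← mul_sum, hγsum]; ring
    _ ≤ 1 / a * (∑ h ∈ H, ρ h) * cG := by gcongr
    _ ≤ _ := mul_le_mul_of_nonneg_right
        (mul_sum_le_rpow_sum_div ⟨h₀, hh₀⟩ hβ (by positivity)
          (fun h hh => hρ h (hHG hh)) fun h hh => hmin h (hHG hh)) hc.le
end

section
/- Let Z, α, β > 0 be reals and let G be a nonempty finite index set. For each g ∈ G let ρ_g > 0, κ_g > 0, and γ_g > 0 be reals with Σ_{g∈G} γ_g = 1. Let a, b > 0 satisfy 1/a = min_{g∈G} γ_g and 1/b = max_{g∈G} γ_g, let r be a real with ρ_f ≤ r·ρ_g for all f, g ∈ G, and let η > 0 be a real with κ_g ≤ η·ρ_g·c_𝒢 for all g ∈ G and η < (b/a)^(β+1)/(r·|G|). Set c := Σ_{g∈G} κ_g·γ_g and n := ((α·β/c)·Σ_{h∈G} ρ_h·γ_h^(−β))^(1/(β+1)). Then for every g ∈ G, γ_g·n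 > (α/Z)^(1/β). -/
/-- The constant `c_𝒢` times the learning ante raised to the power `β + 1` is at most `α * β`. -/
theorem threshold_mul_ante_rpow_le {Z α β : ℝ} (hZ : 0 < Z) (hα : 0 < α) (hβ : 0 < β) :
    Z ^ ((β + 1) / β) /
      (α ^ (1 / β) * (β ^ (-(β / (β + 1))) + β ^ (1 / (β + 1))) ^ ((β + 1) / β)) *
      (α / Z) ^ ((β + 1) / β) ≤ α * β := by
  set D := (β ^ (-(β / (β + 1))) + β ^ (1 / (β + 1))) ^ ((β + 1) / β) with hD
  have hDpos : 0 < D := by positivity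
  have hβD : 1 ≤ β * D := by
    have h : β⁻¹ ≤ D := by
      calc β⁻¹ = (β ^ (-(β / (β + 1)))) ^ ((β + 1) / β) := by
            rw [← Real.rpow_mul hβ.le, ← Real.rpow_neg_one]
            congr 1
            field_simp
        _ ≤ D := Real.rpow_le_rpow (by positivity)
            (le_add_of_nonneg_right (by positivity)) (by positivity)
    calc 1 = β * β⁻¹ := (mul_inv_cancel₀ hβ.ne').symm
      _ ≤ β * D := by gcongr
  have hα' : α ^ ((β + 1) / β) = α ^ (1 / β) * α := by
    rw [← Real.rpow_add_one hα.ne']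
    congr 1
    field_simp
    ring
  have hZp : 0 < Z ^ ((β + 1) / β) := by positivity
  have hαp : 0 < α ^ (1 / β) := by positivity
  rw [Real.div_rpow hα.le hZ.le, hα']
  calc Z ^ ((β + 1) / β) / (α ^ (1 / β) * D) * (α ^ (1 / β) * α / Z ^ ((β + 1) / β))
      = α / D := by field_simp
    _ ≤ α * β := by
      rw [div_le_iff₀ hDpos]
      nlinarith

/-- If every weight `γ h` is at most `M`, then a weighted sum of the `γ h` is controlled by the
same weighted sum of the `γ h ^ (-β)`. -/
theorem sum_mul_le_rpow_mul_sum {ι : Type*} {G : Finset ι} {ρ γ : ι → ℝ} {β M : ℝ}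
    (hβ : 0 < β) (hρ : ∀ h ∈ G, 0 < ρ h) (hγ : ∀ h ∈ G, 0 < γ h) (hM : ∀ h ∈ G, γ h ≤ M) :
    ∑ h ∈ G, ρ h * γ h ≤ M ^ (β + 1) * ∑ h ∈ G, ρ h * γ h ^ (-β) := by
  rw [Finset.mul_sum]
  refine Finset.sum_le_sum fun h hh => ?_
  have hpos := hγ h hh
  have hρh := hρ h hh
  calc ρ h * γ h = γ h ^ (β + 1) * (ρ h * γ h ^ (-β)) := by
        rw [mul_left_comm, ← Real.rpow_add hpos]
        norm_num
    _ ≤ M ^ (β + 1) * (ρ h * γ h ^ (-β)) := by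
        gcongr
        exact hM h hh


open Finset in
/-- Theorem 5.4, second half: every group receives strictly more than the
learning ante at the intervention equilibrium. -/
theorem sufficient_conditions_exceed_learning_ante
    (Z α β : ℝ) (hZ : 0 < Z) (hα : 0 < α) (hβ : 0 < β)
    {ι : Type*} (G : Finset ι) (hG : G.Nonempty)
    (ρ κ γ : ι → ℝ) (hρ : ∀ g ∈ G, 0 < ρ g) (hκ : ∀ g ∈ G, 0 < κ g)
    (hγ : ∀ g ∈ G, 0 < γ g) (hγsum : (∑ g ∈ G, γ g) = 1)
    (cG : ℝ)
    (hcG : cG = Z ^ ((β + 1) / β) /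
      (α ^ (1 / β) * (β ^ (-(β / (β + 1))) + β ^ (1 / (β + 1))) ^ ((β + 1) / β)))
    (a b : ℝ) (ha : 0 < a) (hb : 0 < b)
    (hamin : IsLeast ((G : Set ι).image γ) (1 / a))
    (hbmax : IsGreatest ((G : Set ι).image γ) (1 / b))
    (r : ℝ) (hr : ∀ f ∈ G, ∀ g ∈ G, ρ f ≤ r * ρ g)
    (η : ℝ) (hη0 : 0 < η) (hηκ : ∀ g ∈ G, κ g ≤ η * (ρ g * cG))
    (hη : η < (b / a) ^ (β + 1) / (r * G.card))
    (c : ℝ) (hc : c = ∑ g ∈ G, κ g * γ g)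
    (n : ℝ)
    (hn : n = ((α * β / c) * ∑ h ∈ G, ρ h * (γ h) ^ (-β)) ^ (1 / (β + 1))) :
    ∀ g ∈ G, γ g * n > (α / Z) ^ (1 / β) := by
  intro g hg
  have hρg := hρ g hg
  have hγg := hγ g hg
  have hcGpos : 0 < cG := by rw [hcG]; positivity
  have hr1 : 1 ≤ r := by nlinarith [hr g hg g hg]
  have hcard : (1 : ℝ) ≤ G.card := by exact_mod_cast hG.card_pos
  have hrcard : 1 ≤ r * G.card := one_le_mul_of_one_le_of_one_le hr1 hcard
  have hηlt : η < (b / a) ^ (β + 1) :=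
    hη.trans_le (div_le_self (by positivity) hrcard)
  have hm : 1 / a ≤ γ g := hamin.2 ⟨g, hg, rfl⟩
  have hM : ∀ h ∈ G, γ h ≤ 1 / b := fun h hh => hbmax.2 ⟨h, hh, rfl⟩
  have hante : cG * (α / Z) ^ ((β + 1) / β) ≤ α * β :=
    hcG ▸ threshold_mul_ante_rpow_le hZ hα hβ
  have hcpos : 0 < c := hc ▸ Finset.sum_pos (fun h hh => mul_pos (hκ h hh) (hγ h hh)) hG
  set S := ∑ h ∈ G, ρ h * γ h ^ (-β) with hS
  have hSpos : 0 < S :=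
    Finset.sum_pos (fun h hh => mul_pos (hρ h hh) (Real.rpow_pos_of_pos (hγ h hh) _)) hG
  have hcle : c ≤ η * cG * ((1 / b) ^ (β + 1) * S) := by
    calc c ≤ η * cG * ∑ h ∈ G, ρ h * γ h := by
          rw [hc, Finset.mul_sum]
          refine Finset.sum_le_sum fun h hh => ?_
          nlinarith [mul_le_mul_of_nonneg_right (hηκ h hh) (hγ h hh).le]
      _ ≤ _ := by
          gcongr
          exact sum_mul_le_rpow_mul_sum hβ hρ hγ hM
  have hclt : c < (1 / a) ^ (β + 1) * cG * S := by
    calc c ≤ η * cG * ((1 / b) ^ (β + 1) * S) := hcle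
      _ < (b / a) ^ (β + 1) * cG * ((1 / b) ^ (β + 1) * S) := by gcongr
      _ = ((b / a) ^ (β + 1) * (1 / b) ^ (β + 1)) * cG * S := by ring
      _ = (1 / a) ^ (β + 1) * cG * S := by
          rw [← Real.mul_rpow (by positivity) (by positivity)]
          congr 3
          field_simp
  have hnpow : n ^ (β + 1) = α * β / c * S := by
    rw [hn, ← Real.rpow_mul (by positivity), one_div_mul_cancel (by positivity), Real.rpow_one]
  have hnpos : 0 < n := by rw [hn]; positivity
  have hXpos : 0 < (α / Z) ^ ((β + 1) / β) := by positivity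
  refine lt_of_le_of_lt' (b := 1 / a * n) (by gcongr) ?_
  refine (Real.rpow_lt_rpow_iff (z := β + 1) (by positivity) (by positivity) (by positivity)).1 ?_
  rw [Real.mul_rpow (by positivity) hnpos.le, hnpow, ← Real.rpow_mul (by positivity),
    one_div_mul_eq_div, ← mul_assoc, mul_div_assoc', div_mul_eq_mul_div, lt_div_iff₀ hcpos]
  calc (α / Z) ^ ((β + 1) / β) * c
      < (α / Z) ^ ((β + 1) / β) * ((1 / a) ^ (β + 1) * cG * S) := by gcongr
    _ = (1 / a) ^ (β + 1) * (cG * (α / Z) ^ ((β + 1) / β)) * S := by ring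
    _ ≤ (1 / a) ^ (β + 1) * (α * β) * S := by gcongr
end

section
/- Let Z, α, β, M, c > 0 be reals, let G be a nonempty finite index set, and for each g ∈ G let κ_g > 0 and γ_g > 0 be real constants. Let ρ : ℕ → G → ℝ be a sequence of families of nonnegative reals and set S_n := Σ_{g∈G} ρ_n(g). Assume S_n → ∞ as n → ∞. Define v_n := (Z/M)·S_n − (α/M)·Σ_{g∈G} ρ_n(g)^(1/(β+1))·(α·β/κ_g)^(−β/(β+1)) − (1/M)·Σ_{g∈G} κ_g·((ρ_n(g)/κ_g)·α·β)^(1/(β+1)) and v^f_n := (Z/M)·S_n − (α/M)·(α·β/c)^(−β/(β+1))·(Σ_{g∈G} ρ_n(g)·γ_g^(−β))^(1/(β+1)) − (c/M)·((α·β/c)·Σ_{g∈G} ρ_n(g)·γ_g^(−β))^(1/(β+1)). Then v^f_n / v_n → 1 as n → ∞. -/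
open Filter Asymptotics in
/-- A power `0 ≤ p < 1` of an `O(S)` quantity is `o(S)` when `S → ∞`. -/
theorem isLittleO_rpow_of_isBigO_of_lt_one {α : Type*} {l : Filter α} {x S : α → ℝ} {p : ℝ}
    (hp : 0 ≤ p) (hp1 : p < 1) (hS : Tendsto S l atTop) (hx : x =O[l] S) :
    (fun a => x a ^ p) =o[l] S := by
  have hpow : (fun a => S a ^ p) =o[l] S := by
    refine isLittleO_of_tendsto' ((hS.eventually_ne_atTop 0).mono fun a h h' => absurd h' h) ?_
    refine ((tendsto_rpow_neg_atTop (sub_pos.mpr hp1)).comp hS).congr' ?_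
    filter_upwards [hS.eventually_gt_atTop 0] with a ha
    simp [Real.rpow_sub_one ha.ne']
  exact (hx.rpow hp (hS.eventually_ge_atTop 0)).trans_isLittleO hpow

open Filter Asymptotics in
/-- A nonzero multiple of `S` minus two `o(S)` terms is equivalent to that multiple. -/
theorem isEquivalent_const_mul_sub_sub {α : Type*} {l : Filter α} {S u w : α → ℝ} {k : ℝ}
    (hk : k ≠ 0) (hu : u =o[l] S) (hw : w =o[l] S) :
    IsEquivalent l (fun a => k * S a - u a - w a) fun a => k * S a :=
  (IsEquivalent.refl.sub_isLittleO (hu.const_mul_right hk)).sub_isLittleO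
    (hw.const_mul_right hk)

open Finset Filter in
/-- The sellers' part of Theorem 6.2: as the total potential economic value
grows without bound, the ratio of a seller's intervention utility to its
baseline utility tends to 1. -/
theorem seller_cost_of_fairness_amortizes
    (Z α β M c : ℝ) (hZ : 0 < Z) (hα : 0 < α) (hβ : 0 < β)
    (hM : 0 < M) (hc : 0 < c)
    {ι : Type*} (G : Finset ι) (hG : G.Nonempty)
    (κ γ : ι → ℝ) (hκ : ∀ g ∈ G, 0 < κ g) (hγ : ∀ g ∈ G, 0 < γ g)
    (ρ : ℕ → ι → ℝ) (hρ : ∀ n, ∀ g ∈ G, 0 ≤ ρ n g)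
    (S : ℕ → ℝ) (hS : ∀ n, S n = ∑ g ∈ G, ρ n g)
    (hStop : Tendsto S atTop atTop)
    (v vf : ℕ → ℝ)
    (hv : ∀ n, v n = (Z / M) * S n
      - (α / M) * ∑ g ∈ G, (ρ n g) ^ (1 / (β + 1)) * (α * β / κ g) ^ (-(β / (β + 1)))
      - (1 / M) * ∑ g ∈ G, κ g * ((ρ n g / κ g) * α * β) ^ (1 / (β + 1)))
    (hvf : ∀ n, vf n = (Z / M) * S n
      - (α / M) * (α * β / c) ^ (-(β / (β + 1))) *
          (∑ g ∈ G, ρ n g * (γ g) ^ (-β)) ^ (1 / (β + 1))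
      - (c / M) * ((α * β / c) * ∑ g ∈ G, ρ n g * (γ g) ^ (-β)) ^ (1 / (β + 1))) :
    Tendsto (fun n => vf n / v n) atTop (nhds 1) := by
  have hp : 0 ≤ 1 / (β + 1) := by positivity
  have hp1 : 1 / (β + 1) < 1 := by rw [div_lt_one (by positivity)]; linarith
  have hk : 0 < Z / M := div_pos hZ hM
  have hρS : ∀ g ∈ G, (fun n => ρ n g) =O[atTop] S := fun g hg =>
    Asymptotics.IsBigO.of_bound' <| Eventually.of_forall fun n => by
      rw [Real.norm_of_nonneg (hρ n g hg), hS]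
      exact (Finset.single_le_sum (hρ n) hg).trans (le_abs_self _)
  have hsum : (fun n => ∑ g ∈ G, ρ n g * γ g ^ (-β)) =O[atTop] S :=
    Asymptotics.IsBigO.fun_sum fun g hg => by
      simpa only [mul_comm] using (hρS g hg).const_mul_left (γ g ^ (-β))
  have hv_equiv : Asymptotics.IsEquivalent atTop v fun n => Z / M * S n := by
    rw [funext hv]
    refine isEquivalent_const_mul_sub_sub hk.ne'
      (Asymptotics.IsLittleO.const_mul_left (.fun_sum fun g hg => ?_) _)
      (Asymptotics.IsLittleO.const_mul_left (.fun_sum fun g hg => .const_mul_left ?_ _) _)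
    · simpa only [mul_comm] using
        (isLittleO_rpow_of_isBigO_of_lt_one hp hp1 hStop (hρS g hg)).const_mul_left
          ((α * β / κ g) ^ (-(β / (β + 1))))
    · refine isLittleO_rpow_of_isBigO_of_lt_one hp hp1 hStop
        (((hρS g hg).const_mul_left (α * β / κ g)).congr_left fun n => ?_)
      ring
  have hvf_equiv : Asymptotics.IsEquivalent atTop vf fun n => Z / M * S n := by
    rw [funext hvf]
    exact isEquivalent_const_mul_sub_sub hk.ne'
      ((isLittleO_rpow_of_isBigO_of_lt_one hp hp1 hStop hsum).const_mul_left _)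
      ((isLittleO_rpow_of_isBigO_of_lt_one hp hp1 hStop (hsum.const_mul_left _)).const_mul_left _)
  have hv_top : Tendsto v atTop atTop :=
    hv_equiv.symm.tendsto_atTop (hStop.const_mul_atTop hk)
  exact (Asymptotics.isEquivalent_iff_tendsto_one (hv_top.eventually_ne_atTop 0)).mp
    (hvf_equiv.trans hv_equiv.symm)
end
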